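/- Let k ≥ d ≥ 2 and let E ⊂ ℝ^d be a compact set with Hausdorff dimension dimH E > d − 1. Then for every s with d − 1 < s < dimH E there exist nonempty compact subsets E_1,…,E_k ⊆ E with dimH E_j ≥ s for every j, and a constant c > 0, such that for any choice of d distinct indices i_1,…,i_d ∈ {1,…,k} and any points x^1 ∈ E_{i_1},…, x^d ∈ E_{i_d}, one has |det(x^1,…,x^d)| ≥ c. -/

import Mathlib

open MeasureTheory Metric
open scoped ENNReal

noncomputable section

/-- The determinant of the `d × d` matrix with columns `x 0, …, x (d-1)`. -/
def detCols {d : ℕ} (x : Fin d → EuclideanSpace ℝ (Fin d)) : ℝ :=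
  Matrix.det (Matrix.of fun l i => x i l)

open Filter Topology

/-- The real span of a finite set has Hausdorff dimension at most its cardinality. -/
lemma dimH_span_finset_le {V : Type*} [NormedAddCommGroup V] [NormedSpace ℝ V]
    [FiniteDimensional ℝ V] (S : Finset V) :
    dimH (Submodule.span ℝ (S : Set V) : Set V) ≤ S.card := by
  rw [Real.Convex.dimH_eq_finrank_vectorSpan (Submodule.convex _) ⟨0, Submodule.zero_mem _⟩]
  have h2 : vectorSpan ℝ (Submodule.span ℝ (S : Set V) : Set V) ≤ Submodule.span ℝ (S : Set V) := by
    rw [vectorSpan_def, Submodule.span_le]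
    rintro _ ⟨a, ha, b, hb, rfl⟩
    exact Submodule.sub_mem _ ha hb
  exact_mod_cast (Submodule.finrank_mono h2).trans (finrank_span_finset_le_card S)

/-- A set of dimension larger than `r ≥ d - 1` has a point near which it still has dimension larger
than `r` and which avoids the spans of all sets of fewer than `d` points of a given finite set. -/
lemma exists_lt_dimH_nhdsWithin_notMem_span {V : Type*} [NormedAddCommGroup V] [NormedSpace ℝ V]
    [FiniteDimensional ℝ V] {E : Set V} {r : ℝ≥0∞} {d : ℕ}
    (hd : ∀ m < d, (m : ℝ≥0∞) ≤ r) (hr : r < dimH E) (T : Finset V) :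
    ∃ y ∈ E, (∀ t ∈ 𝓝[E] y, r < dimH t) ∧
      ∀ S ⊆ T, S.card < d → y ∉ Submodule.span ℝ (S : Set V) := by
  set U : Set V := ⋃ S ∈ {S : Finset V | S ⊆ T ∧ S.card < d},
    (Submodule.span ℝ (S : Set V) : Set V)
  have hU : dimH U ≤ r := by
    have hfin : {S : Finset V | S ⊆ T ∧ S.card < d}.Finite :=
      T.powerset.finite_toSet.subset fun S hS => by simpa using hS.1
    rw [dimH_bUnion hfin.countable]
    exact iSup₂_le fun S hS => (dimH_span_finset_le S).trans (hd _ hS.2)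
  have hdiff : r < dimH (E \ U) := by
    have h := hr.trans_le (dimH_mono (Set.subset_sdiff_union E U))
    rw [dimH_union, lt_max_iff] at h
    exact h.resolve_right hU.not_gt
  obtain ⟨y, hy, hloc⟩ := exists_mem_nhdsWithin_lt_dimH_of_lt_dimH hdiff
  refine ⟨y, hy.1, fun t ht => hloc t (nhdsWithin_mono _ Set.sdiff_subset ht), fun S hS hc hyS => ?_⟩
  exact hy.2 (Set.mem_biUnion (show S ∈ {S : Finset V | S ⊆ T ∧ S.card < d} from ⟨hS, hc⟩) hyS)

/-- A set of dimension larger than `r ≥ d - 1` has, for every `k`, `k` points in general linear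
position near each of which it still has dimension larger than `r`. -/
lemma exists_finset_linearIndepOn_lt_dimH_nhdsWithin {V : Type*} [NormedAddCommGroup V]
    [NormedSpace ℝ V] [FiniteDimensional ℝ V] {E : Set V} {r : ℝ≥0∞} {d : ℕ} (hd2 : 2 ≤ d)
    (hd : ∀ m < d, (m : ℝ≥0∞) ≤ r) (hr : r < dimH E) (k : ℕ) :
    ∃ T : Finset V, T.card = k ∧ (∀ y ∈ T, y ∈ E ∧ ∀ t ∈ 𝓝[E] y, r < dimH t) ∧
      ∀ S ⊆ T, S.card ≤ d → LinearIndepOn ℝ id (S : Set V) := by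
  classical
  induction k with
  | zero =>
    refine ⟨∅, rfl, by simp, fun S hS _ => ?_⟩
    rw [Finset.subset_empty.1 hS]
    simp
  | succ k ih =>
    obtain ⟨T, hTk, hT, hind⟩ := ih
    obtain ⟨y, hyE, hy, hspan⟩ := exists_lt_dimH_nhdsWithin_notMem_span hd hr T
    have hyT : y ∉ T := fun h =>
      hspan {y} (by simpa using h) (by simp; omega) (Submodule.subset_span (by simp))
    refine ⟨insert y T, by rw [Finset.card_insert_of_notMem hyT, hTk], ?_, fun S hS hSd => ?_⟩
    · intro z hz
      rcases Finset.mem_insert.1 hz with rfl | hz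
      · exact ⟨hyE, hy⟩
      · exact hT z hz
    · by_cases hyS : y ∈ S
      · have hsub : S.erase y ⊆ T := Finset.subset_insert_iff.1 hS
        have hcard := Finset.card_erase_lt_of_mem hyS
        have h := (hind _ hsub (by omega)).id_insert (hspan _ hsub (by omega))
        rwa [← Finset.coe_insert, Finset.insert_erase hyS] at h
      · exact hind S ((Finset.subset_insert_iff_of_notMem hyS).1 hS) hSd

lemma continuous_detCols {d : ℕ} :
    Continuous (detCols : (Fin d → EuclideanSpace ℝ (Fin d)) → ℝ) := by
  unfold detCols
  refine Continuous.matrix_det ?_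
  refine continuous_matrix fun i j => ?_
  simp only [Matrix.of_apply]
  fun_prop

lemma detCols_ne_zero {d : ℕ} {x : Fin d → EuclideanSpace ℝ (Fin d)}
    (hx : LinearIndependent ℝ x) : detCols x ≠ 0 := by
  have h : LinearIndependent ℝ (Matrix.of fun l i => x i l).col :=
    hx.map' (WithLp.linearEquiv 2 ℝ (Fin d → ℝ)).toLinearMap (LinearEquiv.ker _)
  exact ((Matrix.isUnit_iff_isUnit_det _).1 (Matrix.linearIndependent_cols_iff_isUnit.1 h)).ne_zero

/-- If `d` vectors are linearly independent, then the determinant is bounded away from zero on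
small balls around them. -/
lemma exists_forall_dist_le_le_abs_detCols {d : ℕ} {p : Fin d → EuclideanSpace ℝ (Fin d)}
    (hp : LinearIndependent ℝ p) :
    ∃ δ > 0, ∀ x : Fin d → EuclideanSpace ℝ (Fin d), (∀ i, dist (x i) (p i) ≤ δ) →
      δ ≤ |detCols x| := by
  have hpos : 0 < |detCols p| := abs_pos.2 (detCols_ne_zero hp)
  have hev : ∀ᶠ x in 𝓝 p, |detCols p| / 2 < |detCols x| :=
    continuous_detCols.abs.continuousAt.eventually_const_lt (half_lt_self hpos)
  obtain ⟨ε, hε, hball⟩ := Metric.nhds_basis_closedBall.eventually_iff.1 hev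
  refine ⟨min ε (|detCols p| / 2), lt_min hε (half_pos hpos), fun x hx => ?_⟩
  refine (min_le_right _ _).trans (hball ?_).le
  exact (dist_pi_le_iff hε.le).2 fun i => (hx i).trans (min_le_left _ _)

/-- Paring lemma: a compact set of Hausdorff dimension `> d - 1` contains `k`
compact cells, each of dimension `≥ s` for any `d - 1 < s < dimH E`, such that
any `d` points taken from `d` pairwise distinct cells span a parallelepiped of
volume bounded below by a positive constant. -/
theorem paring_lemma (d k : ℕ) (hd : 2 ≤ d) (hk : d ≤ k)
    (E : Set (EuclideanSpace ℝ (Fin d))) (hE : IsCompact E)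
    (hdim : ENNReal.ofReal ((d : ℝ) - 1) < dimH E)
    (s : ℝ) (hs1 : (d : ℝ) - 1 < s) (hs2 : ENNReal.ofReal s < dimH E) :
    ∃ (Es : Fin k → Set (EuclideanSpace ℝ (Fin d))) (c : ℝ), 0 < c ∧
      (∀ j : Fin k, (Es j).Nonempty ∧ IsCompact (Es j) ∧ Es j ⊆ E ∧
        ENNReal.ofReal s ≤ dimH (Es j)) ∧
      ∀ ι : Fin d → Fin k, Function.Injective ι →
        ∀ x : Fin d → EuclideanSpace ℝ (Fin d), (∀ i, x i ∈ Es (ι i)) →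
          c ≤ |detCols x| := by
  have hd' : ∀ m < d, (m : ℝ≥0∞) ≤ ENNReal.ofReal s := fun m hm => by
    rw [← ENNReal.ofReal_natCast]
    have : (m : ℝ) + 1 ≤ d := by exact_mod_cast hm
    exact ENNReal.ofReal_le_ofReal (by linarith)
  obtain ⟨T, hTk, hT, hind⟩ := exists_finset_linearIndepOn_lt_dimH_nhdsWithin hd hd' hs2 k
  let p : Fin k → EuclideanSpace ℝ (Fin d) := fun j => (T.equivFinOfCardEq hTk).symm j
  have hpT : ∀ j, p j ∈ T := fun j => ((T.equivFinOfCardEq hTk).symm j).2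
  have hpinj : Function.Injective p :=
    Subtype.val_injective.comp (T.equivFinOfCardEq hTk).symm.injective
  have hpind : ∀ ι : {ι : Fin d → Fin k // Function.Injective ι},
      LinearIndependent ℝ fun i => p (ι.1 i) := fun ι => by
    have hinj : Function.Injective fun i => p (ι.1 i) := hpinj.comp ι.2
    have h := hind (Finset.univ.map ⟨_, hinj⟩) (fun y hy => by
      obtain ⟨i, -, rfl⟩ := Finset.mem_map.1 hy
      exact hpT _) (by simp)
    simp only [Finset.coe_map, Finset.coe_univ, Set.image_univ, Function.Embedding.coeFn_mk] at h
    exact (linearIndepOn_id_range_iff hinj).1 h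
  choose δ hδ hdet using fun ι => exists_forall_dist_le_le_abs_detCols (hpind ι)
  obtain ⟨c, hc, hcδ⟩ : ∃ c > 0, ∀ ι, c ≤ δ ι := by
    have : Nonempty {ι : Fin d → Fin k // Function.Injective ι} :=
      ⟨⟨Fin.castLE hk, Fin.castLE_injective hk⟩⟩
    obtain ⟨ι, hι⟩ := Finite.exists_min δ
    exact ⟨δ ι, hδ ι, hι⟩
  refine ⟨fun j => E ∩ closedBall (p j) c, c, hc, fun j => ⟨?_, ?_, Set.inter_subset_left, ?_⟩, ?_⟩
  · exact ⟨p j, (hT _ (hpT j)).1, mem_closedBall_self hc.le⟩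
  · exact hE.inter_right isClosed_closedBall
  · refine ((hT _ (hpT j)).2 _ ?_).le
    exact inter_mem self_mem_nhdsWithin (mem_nhdsWithin_of_mem_nhds (closedBall_mem_nhds _ hc))
  · intro ι hι x hx
    exact (hcδ ⟨ι, hι⟩).trans (hdet ⟨ι, hι⟩ x fun i => (hx i).2.trans (hcδ ⟨ι, hι⟩))
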